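/- arXiv:2502.19792 — 2 statements merged into one kernel-verified Lean document; each statement's English description precedes it below -/
import Mathlib

section
/- Let 𝔅 be nonsingular, b ∈ ℝ^l, w = [x; y; z] = 𝔅^{-1}b, and L ∈ ℝ^{k×l}. Let ν_τ be any norm on ℝ^{s+l} and ν_γ any norm on ℝ^k. Let ξ ∈ ℝ^k, χ ∈ ℝ^l, and a tuple Ψ = (Ψ_A, Ψ_B, Ψ_C, Ψ_D, Ψ_E) of matrices of the same sizes as (A,B,C,D,E), all of whose entries are nonzero. For ε > 0 let S(ε) be the supremum of ν_γ( ξ‡ ⊙ ( L(𝔅+Δ𝔅)^{-1}(b+Δb) − L𝔅^{-1}b ) ) / ν_τ( [vec(Ψ_A‡⊙ΔA); vec(Ψ_B‡⊙ΔB); vec(Ψ_C‡⊙ΔC); vec(Ψ_D‡⊙ΔD); vec(Ψ_E‡⊙ΔE); χ‡⊙Δb] ) over all perturbations ΔA ∈ ℝ^{n×n}, ΔB ∈ ℝ^{m×n}, ΔC ∈ ℝ^{p×m}, ΔD ∈ ℝ^{m×m}, ΔE ∈ ℝ^{p×p}, Δb ∈ ℝ^l for which Δ𝔅 = [[ΔA,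 ΔBᵀ, 0],[ΔB, −ΔD, ΔCᵀ],[0, ΔC, ΔE]] makes 𝔅+Δ𝔅 nonsingular and 0 < ν_τ([vec(Ψ_A‡⊙ΔA); …; vec(Ψ_E‡⊙ΔE); χ‡⊙Δb]) ≤ ε. Then S(ε) tends, as ε → 0⁺, to ‖Θ_{ξ‡} · L · 𝔅^{-1} · [𝒢, −I_l] · blkdiag(Θ_{vec(Ψ)}, Θ_χ)‖_{τ,γ}, where vec(Ψ) = [vec(Ψ_A); vec(Ψ_B); vec(Ψ_C); vec(Ψ_D); vec(Ψ_E)] and ‖M‖_{τ,γ} = sup_{v ≠ 0} ν_γ(M v)/ν_τ(v) is the induced matrix norm. -/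
open Matrix Filter Topology

noncomputable section

/-- Index type for block vectors of sizes `n, m, p` (the paper's `l = n + m + p`). -/
abbrev Idx (n m p : ℕ) := Fin n ⊕ (Fin m ⊕ Fin p)

/-- Index type for the stacked vector `[vec A; vec B; vec C; vec D; vec E]`
(the paper's `s = n² + nm + mp + m² + p²`). -/
abbrev GIdx (n m p : ℕ) :=
  (Fin n × Fin n) ⊕ ((Fin n × Fin m) ⊕ ((Fin m × Fin p) ⊕ ((Fin m × Fin m) ⊕ (Fin p × Fin p))))

/-- Column-stacking vectorization of a `q × r` matrix: `vecC X (j, i) = X i j`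
(index = (column, row)). -/
def vecC {q r : ℕ} (X : Matrix (Fin q) (Fin r) ℝ) : Fin r × Fin q → ℝ := fun c => X c.2 c.1

/-- The double saddle point block matrix `[[A, Bᵀ, 0], [B, -D, Cᵀ], [0, C, E]]`. -/
def dsp {n m p : ℕ} (A : Matrix (Fin n) (Fin n) ℝ) (B : Matrix (Fin m) (Fin n) ℝ)
    (C : Matrix (Fin p) (Fin m) ℝ) (D : Matrix (Fin m) (Fin m) ℝ)
    (E : Matrix (Fin p) (Fin p) ℝ) : Matrix (Idx n m p) (Idx n m p) ℝ :=
  Matrix.of fun i j =>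
    match i, j with
    | Sum.inl i, Sum.inl j => A i j
    | Sum.inl i, Sum.inr (Sum.inl j) => Bᵀ i j
    | Sum.inl _, Sum.inr (Sum.inr _) => 0
    | Sum.inr (Sum.inl i), Sum.inl j => B i j
    | Sum.inr (Sum.inl i), Sum.inr (Sum.inl j) => -D i j
    | Sum.inr (Sum.inl i), Sum.inr (Sum.inr j) => Cᵀ i j
    | Sum.inr (Sum.inr _), Sum.inl _ => 0
    | Sum.inr (Sum.inr i), Sum.inr (Sum.inl j) => C i j
    | Sum.inr (Sum.inr i), Sum.inr (Sum.inr j) => E i j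

/-- The matrix `𝒢 = [[xᵀ⊗Iₙ, Iₙ⊗yᵀ, 0, 0, 0], [0, xᵀ⊗Iₘ, Iₘ⊗zᵀ, -(yᵀ⊗Iₘ), 0],
[0, 0, yᵀ⊗Iₚ, 0, zᵀ⊗Iₚ]] ∈ ℝ^{l×s}`, written entrywise with respect to the
column-stacking indices (so that `𝒢 ·ᵥ [vec ΔA; vec ΔB; vec ΔC; vec ΔD; vec ΔE]`
is exactly the action of the Kronecker-product block matrix of the paper). -/
def calG {n m p : ℕ} (x : Fin n → ℝ) (y : Fin m → ℝ) (z : Fin p → ℝ) :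
    Matrix (Idx n m p) (GIdx n m p) ℝ :=
  Matrix.of fun i c =>
    match i, c with
    | Sum.inl i, Sum.inl (j, i') => x j * (if i = i' then 1 else 0)
    | Sum.inl i, Sum.inr (Sum.inl (j, i')) => (if i = j then 1 else 0) * y i'
    | Sum.inl _, Sum.inr (Sum.inr (Sum.inl _)) => 0
    | Sum.inl _, Sum.inr (Sum.inr (Sum.inr (Sum.inl _))) => 0
    | Sum.inl _, Sum.inr (Sum.inr (Sum.inr (Sum.inr _))) => 0
    | Sum.inr (Sum.inl _), Sum.inl _ => 0
    | Sum.inr (Sum.inl i), Sum.inr (Sum.inl (j, i')) => x j * (if i = i' then 1 else 0)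
    | Sum.inr (Sum.inl i), Sum.inr (Sum.inr (Sum.inl (j, i'))) => (if i = j then 1 else 0) * z i'
    | Sum.inr (Sum.inl i), Sum.inr (Sum.inr (Sum.inr (Sum.inl (j, i')))) =>
        -(y j * (if i = i' then 1 else 0))
    | Sum.inr (Sum.inl _), Sum.inr (Sum.inr (Sum.inr (Sum.inr _))) => 0
    | Sum.inr (Sum.inr _), Sum.inl _ => 0
    | Sum.inr (Sum.inr _), Sum.inr (Sum.inl _) => 0
    | Sum.inr (Sum.inr i), Sum.inr (Sum.inr (Sum.inl (j, i'))) => y j * (if i = i' then 1 else 0)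
    | Sum.inr (Sum.inr _), Sum.inr (Sum.inr (Sum.inr (Sum.inl _))) => 0
    | Sum.inr (Sum.inr i), Sum.inr (Sum.inr (Sum.inr (Sum.inr (j, i')))) =>
        z j * (if i = i' then 1 else 0)

/-- The stacked vector `[vec A; vec B; vec C; vec D; vec E]`. -/
def vecG {n m p : ℕ} (A : Matrix (Fin n) (Fin n) ℝ) (B : Matrix (Fin m) (Fin n) ℝ)
    (C : Matrix (Fin p) (Fin m) ℝ) (D : Matrix (Fin m) (Fin m) ℝ)
    (E : Matrix (Fin p) (Fin p) ℝ) : GIdx n m p → ℝ :=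
  Sum.elim (vecC A) (Sum.elim (vecC B) (Sum.elim (vecC C) (Sum.elim (vecC D) (vecC E))))

/-- Euclidean norm of a vector. -/
def euclNorm {ι : Type*} [Fintype ι] (v : ι → ℝ) : ℝ := Real.sqrt (∑ i, v i ^ 2)

/-- Spectral norm (largest singular value = induced 2-norm) of a real matrix. -/
def specNorm {a b : Type*} [Fintype a] [Fintype b] (M : Matrix a b ℝ) : ℝ :=
  sSup {r : ℝ | ∃ v : b → ℝ, euclNorm v = 1 ∧ r = euclNorm (M.mulVec v)}

/-- Max-norm (`‖·‖_∞`) of a vector. -/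
def infNormV {ι : Type*} [Fintype ι] (v : ι → ℝ) : ℝ := ⨆ i, |v i|

/-- Induced ∞-norm of a matrix: the maximum absolute row sum. -/
def infNormM {a b : Type*} [Fintype a] [Fintype b] (M : Matrix a b ℝ) : ℝ :=
  ⨆ i, ∑ j, |M i j|

/-- Horizontal (block-column) concatenation `[M, N]`. -/
def hcat {a b c : Type*} (M : Matrix a b ℝ) (N : Matrix a c ℝ) : Matrix a (b ⊕ c) ℝ :=
  Matrix.of fun i => Sum.elim (M i) (N i)

/-- Entrywise absolute value of a matrix. -/
def absM {a b : Type*} (M : Matrix a b ℝ) : Matrix a b ℝ := Matrix.of fun i j => |M i j|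

/-- Entrywise absolute value of a vector. -/
def absV {ι : Type*} (v : ι → ℝ) : ι → ℝ := fun i => |v i|

/-- The matrix `𝒥 = [[(‖x‖₂²+‖y‖₂²)Iₙ, xyᵀ, 0], [yxᵀ, (‖x‖₂²+‖y‖₂²+‖z‖₂²)Iₘ, yzᵀ],
[0, zyᵀ, (‖y‖₂²+‖z‖₂²)Iₚ]]`. -/
def calJ {n m p : ℕ} (x : Fin n → ℝ) (y : Fin m → ℝ) (z : Fin p → ℝ) :
    Matrix (Idx n m p) (Idx n m p) ℝ :=
  Matrix.of fun i j =>
    match i, j with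
    | Sum.inl i, Sum.inl j => (euclNorm x ^ 2 + euclNorm y ^ 2) * (if i = j then 1 else 0)
    | Sum.inl i, Sum.inr (Sum.inl j) => x i * y j
    | Sum.inl _, Sum.inr (Sum.inr _) => 0
    | Sum.inr (Sum.inl i), Sum.inl j => y i * x j
    | Sum.inr (Sum.inl i), Sum.inr (Sum.inl j) =>
        (euclNorm x ^ 2 + euclNorm y ^ 2 + euclNorm z ^ 2) * (if i = j then 1 else 0)
    | Sum.inr (Sum.inl i), Sum.inr (Sum.inr j) => y i * z j
    | Sum.inr (Sum.inr _), Sum.inl _ => 0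
    | Sum.inr (Sum.inr i), Sum.inr (Sum.inl j) => z i * y j
    | Sum.inr (Sum.inr i), Sum.inr (Sum.inr j) =>
        (euclNorm y ^ 2 + euclNorm z ^ 2) * (if i = j then 1 else 0)

/-- The scaled perturbation vector
`[vec(Ψ_A‡⊙ΔA); vec(Ψ_B‡⊙ΔB); vec(Ψ_C‡⊙ΔC); vec(Ψ_D‡⊙ΔD); vec(Ψ_E‡⊙ΔE); χ‡⊙Δb]`
(for data with all entries nonzero, `v‡` is the entrywise reciprocal). -/
def scaledPert {n m p : ℕ} (ΨA : Matrix (Fin n) (Fin n) ℝ) (ΨB : Matrix (Fin m) (Fin n) ℝ)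
    (ΨC : Matrix (Fin p) (Fin m) ℝ) (ΨD : Matrix (Fin m) (Fin m) ℝ)
    (ΨE : Matrix (Fin p) (Fin p) ℝ) (χ : Idx n m p → ℝ)
    (ΔA : Matrix (Fin n) (Fin n) ℝ) (ΔB : Matrix (Fin m) (Fin n) ℝ)
    (ΔC : Matrix (Fin p) (Fin m) ℝ) (ΔD : Matrix (Fin m) (Fin m) ℝ)
    (ΔE : Matrix (Fin p) (Fin p) ℝ) (Δb : Idx n m p → ℝ) : GIdx n m p ⊕ Idx n m p → ℝ :=
  Sum.elim (fun c => (vecG ΨA ΨB ΨC ΨD ΨE c)⁻¹ * vecG ΔA ΔB ΔC ΔD ΔE c)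
    (fun i => (χ i)⁻¹ * Δb i)

/-- The vector `ℋ = [|A||x| + |B|ᵀ|y|; |B||x| + |D||y| + |C|ᵀ|z|; |C||y| + |E||z|]`. -/
def calH {n m p : ℕ} (A : Matrix (Fin n) (Fin n) ℝ) (B : Matrix (Fin m) (Fin n) ℝ)
    (C : Matrix (Fin p) (Fin m) ℝ) (D : Matrix (Fin m) (Fin m) ℝ)
    (E : Matrix (Fin p) (Fin p) ℝ) (x : Fin n → ℝ) (y : Fin m → ℝ) (z : Fin p → ℝ) :
    Idx n m p → ℝ :=
  Sum.elim ((absM A).mulVec (absV x) + (absM B)ᵀ.mulVec (absV y))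
    (Sum.elim
      ((absM B).mulVec (absV x) + (absM D).mulVec (absV y) + (absM C)ᵀ.mulVec (absV z))
      ((absM C).mulVec (absV y) + (absM E).mulVec (absV z)))

/-- Index type of the structured (generating-vector) parameter space
`[a; vec B; vec C; d; e]`. -/
abbrev SIdx (n m p s₁ r q : ℕ) :=
  Fin s₁ ⊕ (((Fin n × Fin m) ⊕ (Fin m × Fin p)) ⊕ (Fin r ⊕ Fin q))

/-- `Φ_S = blkdiag(Φ₁, I_{nm+mp}, Φ₂, Φ₃)`. -/
def PhiS {n m p s₁ r q : ℕ} (Φ₁ : Matrix (Fin n × Fin n) (Fin s₁) ℝ)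
    (Φ₂ : Matrix (Fin m × Fin m) (Fin r) ℝ) (Φ₃ : Matrix (Fin p × Fin p) (Fin q) ℝ) :
    Matrix (GIdx n m p) (SIdx n m p s₁ r q) ℝ :=
  Matrix.of fun i j =>
    match i, j with
    | Sum.inl i, Sum.inl j => Φ₁ i j
    | Sum.inr (Sum.inl i), Sum.inr (Sum.inl (Sum.inl j)) => if i = j then 1 else 0
    | Sum.inr (Sum.inr (Sum.inl i)), Sum.inr (Sum.inl (Sum.inr j)) => if i = j then 1 else 0
    | Sum.inr (Sum.inr (Sum.inr (Sum.inl i))), Sum.inr (Sum.inr (Sum.inl j)) => Φ₂ i j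
    | Sum.inr (Sum.inr (Sum.inr (Sum.inr i))), Sum.inr (Sum.inr (Sum.inr j)) => Φ₃ i j
    | _, _ => 0

/-- The structured scaled perturbation vector
`[ψ_A‡⊙Δa; vec(Ψ_B‡⊙ΔB); vec(Ψ_C‡⊙ΔC); ψ_D‡⊙Δd; ψ_E‡⊙Δe; χ‡⊙Δb]`. -/
def structPert {n m p s₁ r q : ℕ} (ψA : Fin s₁ → ℝ) (ΨB : Matrix (Fin m) (Fin n) ℝ)
    (ΨC : Matrix (Fin p) (Fin m) ℝ) (ψD : Fin r → ℝ) (ψE : Fin q → ℝ) (χ : Idx n m p → ℝ)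
    (Δa : Fin s₁ → ℝ) (ΔB : Matrix (Fin m) (Fin n) ℝ) (ΔC : Matrix (Fin p) (Fin m) ℝ)
    (Δd : Fin r → ℝ) (Δe : Fin q → ℝ) (Δb : Idx n m p → ℝ) :
    SIdx n m p s₁ r q ⊕ Idx n m p → ℝ :=
  Sum.elim
    (Sum.elim (fun j => (ψA j)⁻¹ * Δa j)
      (Sum.elim
        (Sum.elim (fun c => (vecC ΨB c)⁻¹ * vecC ΔB c) (fun c => (vecC ΨC c)⁻¹ * vecC ΔC c))
        (Sum.elim (fun j => (ψD j)⁻¹ * Δd j) (fun j => (ψE j)⁻¹ * Δe j))))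
    (fun i => (χ i)⁻¹ * Δb i)

/-- The EILS augmented matrix `𝔅̂ = [[0, 0, C], [0, J, M], [Cᵀ, Mᵀ, 0]]`
(block sizes `p, n, m`). -/
def eilsAug {n m p : ℕ} (J : Matrix (Fin n) (Fin n) ℝ) (M : Matrix (Fin n) (Fin m) ℝ)
    (C : Matrix (Fin p) (Fin m) ℝ) :
    Matrix (Fin p ⊕ (Fin n ⊕ Fin m)) (Fin p ⊕ (Fin n ⊕ Fin m)) ℝ :=
  Matrix.of fun i j =>
    match i, j with
    | Sum.inl i, Sum.inr (Sum.inr j) => C i j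
    | Sum.inr (Sum.inl i), Sum.inr (Sum.inl j) => J i j
    | Sum.inr (Sum.inl i), Sum.inr (Sum.inr j) => M i j
    | Sum.inr (Sum.inr i), Sum.inl j => Cᵀ i j
    | Sum.inr (Sum.inr i), Sum.inr (Sum.inl j) => Mᵀ i j
    | _, _ => 0

/-- The block permutation matrix `Σ = [[0, Iₙ, 0], [0, 0, Iₘ], [I_p, 0, 0]]`
(block rows of sizes `n, m, p`; block columns of sizes `p, n, m`). -/
def sigmaPerm (n m p : ℕ) : Matrix (Idx n m p) (Fin p ⊕ (Fin n ⊕ Fin m)) ℝ :=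
  Matrix.of fun i j =>
    match i, j with
    | Sum.inl i, Sum.inr (Sum.inl j) => if i = j then 1 else 0
    | Sum.inr (Sum.inl i), Sum.inr (Sum.inr j) => if i = j then 1 else 0
    | Sum.inr (Sum.inr i), Sum.inl j => if i = j then 1 else 0
    | _, _ => 0

/-- The matrix `𝒢̂ = [[yᵀ⊗Iₙ, 0], [Iₘ⊗xᵀ, Iₘ⊗zᵀ], [0, yᵀ⊗I_p]] ∈ ℝ^{l×m(n+p)}`,
written entrywise with respect to column-stacking indices of `[vec(ΔBᵀ); vec(ΔC)]`. -/
def hatG {n m p : ℕ} (x : Fin n → ℝ) (y : Fin m → ℝ) (z : Fin p → ℝ) :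
    Matrix (Idx n m p) ((Fin m × Fin n) ⊕ (Fin m × Fin p)) ℝ :=
  Matrix.of fun i c =>
    match i, c with
    | Sum.inl i, Sum.inl (j, i') => y j * (if i = i' then 1 else 0)
    | Sum.inl _, Sum.inr _ => 0
    | Sum.inr (Sum.inl i), Sum.inl (j, i') => (if i = j then 1 else 0) * x i'
    | Sum.inr (Sum.inl i), Sum.inr (j, i') => (if i = j then 1 else 0) * z i'
    | Sum.inr (Sum.inr _), Sum.inl _ => 0
    | Sum.inr (Sum.inr i), Sum.inr (j, i') => y j * (if i = i' then 1 else 0)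

/-- A function satisfying the norm laws is nonnegative. -/
theorem nonneg_of_norm_laws {V : Type*} [AddCommGroup V] [Module ℝ V] {ν : V → ℝ}
    (h0 : ∀ v, ν v = 0 ↔ v = 0) (hh : ∀ (c : ℝ) v, ν (c • v) = |c| * ν v)
    (ht : ∀ u v, ν (u + v) ≤ ν u + ν v) (v : V) : 0 ≤ ν v := by
  have h1 := ht v ((-1 : ℝ) • v)
  rw [neg_one_smul, add_neg_cancel, (h0 0).2 rfl, ← neg_one_smul ℝ v, hh] at h1
  norm_num at h1
  linarith

/-- A norm on a finite-dimensional coordinate space, given as a bare function, is bounded by a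
multiple of the sup norm. -/
theorem exists_le_mul_norm_of_norm_laws {ι : Type*} [Fintype ι] {ν : (ι → ℝ) → ℝ}
    (h0 : ∀ v, ν v = 0 ↔ v = 0) (hh : ∀ (c : ℝ) v, ν (c • v) = |c| * ν v)
    (ht : ∀ u v, ν (u + v) ≤ ν u + ν v) : ∃ K, 0 < K ∧ ∀ v, ν v ≤ K * ‖v‖ := by
  classical
  have hnn := nonneg_of_norm_laws h0 hh ht
  refine ⟨∑ i, ν (Pi.single i 1) + 1,
    add_pos_of_nonneg_of_pos (Finset.sum_nonneg fun i _ => hnn _) one_pos, fun v => ?_⟩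
  calc ν v = ν (∑ i, v i • Pi.single i (1 : ℝ)) := by rw [← pi_eq_sum_univ' v]
    _ ≤ ∑ i, ν (v i • Pi.single i (1 : ℝ)) :=
        Finset.le_sum_of_subadditive ν ((h0 0).2 rfl).le ht _ _
    _ ≤ ∑ i, ‖v‖ * ν (Pi.single i 1) := Finset.sum_le_sum fun i _ => by
        rw [hh]
        exact mul_le_mul_of_nonneg_right (norm_le_pi_norm v i) (hnn _)
    _ ≤ (∑ i, ν (Pi.single i 1) + 1) * ‖v‖ := by
        rw [← Finset.mul_sum]
        nlinarith [norm_nonneg v]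

/-- A norm on a finite-dimensional coordinate space, given as a bare function, dominates a
multiple of the sup norm. -/
theorem exists_mul_norm_le_of_norm_laws {ι : Type*} [Fintype ι] {ν : (ι → ℝ) → ℝ}
    (h0 : ∀ v, ν v = 0 ↔ v = 0) (hh : ∀ (c : ℝ) v, ν (c • v) = |c| * ν v)
    (ht : ∀ u v, ν (u + v) ≤ ν u + ν v) : ∃ c, 0 < c ∧ ∀ v, c * ‖v‖ ≤ ν v := by
  obtain ⟨K, hK, hb⟩ := exists_le_mul_norm_of_norm_laws h0 hh ht
  have hnn := nonneg_of_norm_laws h0 hh ht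
  have hsub : ∀ u v, ν u - ν v ≤ K * ‖u - v‖ := fun u v => by
    have h1 := ht (u - v) v
    rw [sub_add_cancel] at h1
    linarith [hb (u - v)]
  have hcont : Continuous ν := by
    refine (LipschitzWith.of_dist_le_mul (K := ⟨K, hK.le⟩) fun u v => ?_).continuous
    rw [Real.dist_eq, dist_eq_norm, abs_le]
    have h1 := hsub u v
    have h2 := hsub v u
    rw [norm_sub_rev] at h2
    exact ⟨neg_le.1 (by rwa [neg_sub]), h1⟩
  rcases (Metric.sphere (0 : ι → ℝ) 1).eq_empty_or_nonempty with he | hne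
  · refine ⟨1, one_pos, fun v => ?_⟩
    by_cases hv : v = 0
    · simp [hv, (h0 0).2 rfl]
    · have : ‖v‖⁻¹ • v ∈ Metric.sphere (0 : ι → ℝ) 1 := by
        simp [norm_smul, norm_ne_zero_iff.2 hv]
      simp [he] at this
  · obtain ⟨u, hu, hmin⟩ := (isCompact_sphere (0 : ι → ℝ) 1).exists_isMinOn hne hcont.continuousOn
    have hu0 : u ≠ 0 := by
      rintro rfl
      simp at hu
    refine ⟨ν u, (hnn u).lt_of_ne fun h => hu0 ((h0 u).1 h.symm), fun v => ?_⟩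
    by_cases hv : v = 0
    · simp [hv, (h0 0).2 rfl]
    · have hpos := norm_pos_iff.2 hv
      have : ν u ≤ ν (‖v‖⁻¹ • v) := hmin (by simp [norm_smul, norm_ne_zero_iff.2 hv])
      rw [hh, abs_of_pos (inv_pos.2 hpos), ← div_eq_inv_mul] at this
      exact (le_div_iff₀ hpos).1 this

/-- A matrix family tending to zero acts as a little-o of the argument. -/
theorem isLittleO_mulVec_self {ι κ : Type*} [Fintype ι] [Fintype κ]
    {T : (ι → ℝ) → Matrix κ ι ℝ} (hT : Tendsto T (𝓝 0) (𝓝 0)) :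
    (fun v => T v *ᵥ v) =o[𝓝 0] (fun v => v) := by
  refine Asymptotics.IsLittleO.of_norm_right ?_
  rw [Asymptotics.isLittleO_pi]
  intro i
  suffices h : ∀ j ∈ Finset.univ, (fun v => T v i j * v j) =o[𝓝 0] (fun v => ‖v‖) from
    (Asymptotics.IsLittleO.sum h).congr_left fun v => by simp [Matrix.mulVec, dotProduct]
  intro j _
  have h1 : (fun v => T v i j) =o[𝓝 0] (fun _ => (1 : ℝ)) := by
    rw [Asymptotics.isLittleO_one_iff]
    exact ((continuous_id.matrix_elem i j).tendsto (0 : Matrix κ ι ℝ)).comp hT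
  have h2 : (fun v : ι → ℝ => v j) =O[𝓝 0] (fun v => ‖v‖) :=
    Asymptotics.IsBigO.of_bound 1 (.of_forall fun v => by simpa using norm_le_pi_norm v j)
  simpa using h1.mul_isBigO h2

/-- The local ratios of `v ↦ T v *ᵥ v` near the origin converge to the induced norm of `T 0`. -/
theorem tendsto_sSup_ratio {ι κ : Type*} [Fintype ι] [Fintype κ]
    {T : (ι → ℝ) → Matrix κ ι ℝ} (hT : ContinuousAt T 0)
    {P : (ι → ℝ) → Prop} (hP : ∀ᶠ v in 𝓝 0, P v)
    {ν : (ι → ℝ) → ℝ} {γ : (κ → ℝ) → ℝ}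
    (hν0 : ∀ v, ν v = 0 ↔ v = 0) (hνh : ∀ (c : ℝ) v, ν (c • v) = |c| * ν v)
    (hνt : ∀ u v, ν (u + v) ≤ ν u + ν v)
    (hγ0 : ∀ v, γ v = 0 ↔ v = 0) (hγh : ∀ (c : ℝ) v, γ (c • v) = |c| * γ v)
    (hγt : ∀ u v, γ (u + v) ≤ γ u + γ v) :
    Tendsto (fun ε : ℝ => sSup {t : ℝ | ∃ v, P v ∧ 0 < ν v ∧ ν v ≤ ε ∧ t = γ (T v *ᵥ v) / ν v})
      (𝓝[>] 0) (𝓝 (sSup {t : ℝ | ∃ v, v ≠ 0 ∧ t = γ (T 0 *ᵥ v) / ν v})) := by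
  obtain ⟨c, hc, hcν⟩ := exists_mul_norm_le_of_norm_laws hν0 hνh hνt
  obtain ⟨K, hK, hKγ⟩ := exists_le_mul_norm_of_norm_laws hγ0 hγh hγt
  have hγnn := nonneg_of_norm_laws hγ0 hγh hγt
  have hνpos : ∀ {v}, v ≠ 0 → 0 < ν v := fun {v} hv =>
    (mul_pos hc (norm_pos_iff.2 hv)).trans_le (hcν v)
  have hγneg : ∀ w, γ (-w) = γ w := fun w => by simpa using hγh (-1) w
  set M := sSup {t : ℝ | ∃ v, v ≠ 0 ∧ t = γ (T 0 *ᵥ v) / ν v} with hM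
  have hM0 : 0 ≤ M := Real.sSup_nonneg (by
    rintro _ ⟨v, hv, rfl⟩
    exact div_nonneg (hγnn _) (hνpos hv).le)
  have hbdd : BddAbove {t : ℝ | ∃ v, v ≠ 0 ∧ t = γ (T 0 *ᵥ v) / ν v} := by
    let f := LinearMap.toContinuousLinearMap (Matrix.mulVecLin (T 0))
    refine ⟨K * ‖f‖ / c, ?_⟩
    rintro _ ⟨v, hv, rfl⟩
    rw [div_le_div_iff₀ (hνpos hv) hc]
    have h1 : ‖T 0 *ᵥ v‖ ≤ ‖f‖ * ‖v‖ := f.le_opNorm v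
    calc γ (T 0 *ᵥ v) * c ≤ K * (‖f‖ * ‖v‖) * c := by
          gcongr
          exact (hKγ _).trans (by gcongr)
      _ = K * ‖f‖ * (c * ‖v‖) := by ring
      _ ≤ K * ‖f‖ * ν v := by
          gcongr
          exact hcν v
  rw [Metric.tendsto_nhds]
  intro r hr
  have hη : 0 < r / 2 := by positivity
  have hsmall := (isLittleO_mulVec_self (T := fun v => T v - T 0)
    (by simpa using hT.tendsto.sub_const (T 0))).def (show 0 < r / 2 * c / K by positivity)
  obtain ⟨δ, hδ, hball⟩ := Metric.eventually_nhds_iff.1 (hP.and hsmall)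
  have hloc : ∀ v, ν v < c * δ → P v ∧ γ (T v *ᵥ v - T 0 *ᵥ v) ≤ r / 2 * ν v := fun v hv => by
    have hvδ : ‖v‖ < δ := lt_of_mul_lt_mul_left ((hcν v).trans_lt hv) hc.le
    obtain ⟨h1, h2⟩ := hball (by simpa using hvδ)
    refine ⟨h1, ?_⟩
    rw [← Matrix.sub_mulVec]
    calc _ ≤ K * ‖(T v - T 0) *ᵥ v‖ := hKγ _
      _ ≤ K * (r / 2 * c / K * ‖v‖) := by gcongr
      _ = r / 2 * (c * ‖v‖) := by field_simp
      _ ≤ r / 2 * ν v := by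
          gcongr
          exact hcν v
  filter_upwards [Ioo_mem_nhdsGT (show (0 : ℝ) < c * δ by positivity)] with ε hε
  set S := {t : ℝ | ∃ v, P v ∧ 0 < ν v ∧ ν v ≤ ε ∧ t = γ (T v *ᵥ v) / ν v} with hS
  have hup : ∀ t ∈ S, t ≤ M + r / 2 := by
    rintro _ ⟨v, -, hv, hvε, rfl⟩
    have hv0 : v ≠ 0 := fun h => hv.ne' ((hν0 v).2 h)
    have h1 : γ (T 0 *ᵥ v) / ν v ≤ M := le_csSup hbdd ⟨v, hv0, rfl⟩
    have h2 := hγt (T 0 *ᵥ v) (T v *ᵥ v - T 0 *ᵥ v)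
    rw [add_sub_cancel] at h2
    rw [div_le_iff₀ hv] at h1 ⊢
    linarith [(hloc v (hvε.trans_lt hε.2)).2]
  have hSnn : 0 ≤ sSup S := Real.sSup_nonneg (by
    rintro _ ⟨v, -, hv, -, rfl⟩
    exact div_nonneg (hγnn _) hv.le)
  have hlow : M ≤ sSup S + r / 2 := by
    refine Real.sSup_le ?_ (by positivity)
    rintro _ ⟨u, hu, rfl⟩
    have hupos := hνpos hu
    have ha : 0 < ε / ν u := div_pos hε.1 hupos
    set v := (ε / ν u) • u with hv
    have hvε : ν v = ε := by
      rw [hv, hνh, abs_of_pos ha]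
      field_simp
    obtain ⟨h1, h2⟩ := hloc v (hvε.trans_lt hε.2)
    have h3 : γ (T v *ᵥ v) / ν v ≤ sSup S :=
      le_csSup ⟨_, hup⟩ ⟨v, h1, hvε ▸ hε.1, hvε.le, rfl⟩
    have h4 : γ (T 0 *ᵥ v) / ν v = γ (T 0 *ᵥ u) / ν u := by
      rw [hvε, hv, Matrix.mulVec_smul, hγh, abs_of_pos ha]
      field_simp [hε.1.ne']
    have h5 := hγt (T v *ᵥ v) (-(T v *ᵥ v - T 0 *ᵥ v))
    rw [hγneg, neg_sub, add_sub_cancel] at h5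
    rw [← h4]
    have hvpos : 0 < ν v := hvε ▸ hε.1
    rw [div_le_iff₀ hvpos] at h3 ⊢
    linarith
  have hle : sSup S ≤ M + r / 2 := Real.sSup_le hup (by positivity)
  rw [Real.dist_eq, abs_lt]
  constructor <;> linarith

/-- The matrix `𝒢` represents the action of a structured perturbation on `[x; y; z]`. -/
theorem calG_mulVec_vecG {n m p : ℕ} (A : Matrix (Fin n) (Fin n) ℝ) (B : Matrix (Fin m) (Fin n) ℝ)
    (C : Matrix (Fin p) (Fin m) ℝ) (D : Matrix (Fin m) (Fin m) ℝ) (E : Matrix (Fin p) (Fin p) ℝ)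
    (x : Fin n → ℝ) (y : Fin m → ℝ) (z : Fin p → ℝ) :
    calG x y z *ᵥ vecG A B C D E = dsp A B C D E *ᵥ Sum.elim x (Sum.elim y z) := by
  ext i
  rcases i with i | i | i <;>
    simp [Matrix.mulVec, dotProduct, calG, vecG, vecC, dsp, Fintype.sum_sum_type,
      Fintype.sum_prod_type, mul_comm, add_comm]

/-- The left block row `[M, N]` acts blockwise. -/
theorem hcat_mulVec {a b c : Type*} [Fintype b] [Fintype c] (M : Matrix a b ℝ) (N : Matrix a c ℝ)
    (v : b ⊕ c → ℝ) : hcat M N *ᵥ v = M *ᵥ (v ∘ Sum.inl) + N *ᵥ (v ∘ Sum.inr) := by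
  ext i
  simp [Matrix.mulVec, dotProduct, hcat, Fintype.sum_sum_type]

/-- Perturbing a nonsingular linear system: the exact change of the solution. -/
theorem inv_add_mulVec_sub {ι : Type*} [Fintype ι] [DecidableEq ι] {M N : Matrix ι ι ℝ}
    (hM : IsUnit M.det) (hMN : IsUnit (M + N).det) (b d : ι → ℝ) :
    (M + N)⁻¹ *ᵥ (b + d) - M⁻¹ *ᵥ b = -((M + N)⁻¹ *ᵥ (N *ᵥ (M⁻¹ *ᵥ b) - d)) := by
  have h : M⁻¹ *ᵥ b = (M + N)⁻¹ *ᵥ ((M + N) *ᵥ (M⁻¹ *ᵥ b)) := by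
    rw [Matrix.mulVec_mulVec, Matrix.nonsing_inv_mul _ hMN, Matrix.one_mulVec]
  have h2 : M *ᵥ (M⁻¹ *ᵥ b) = b := by
    rw [Matrix.mulVec_mulVec, Matrix.mul_nonsing_inv _ hM, Matrix.one_mulVec]
  conv_lhs => rw [h]
  rw [← Matrix.mulVec_sub, Matrix.add_mulVec, h2, ← Matrix.mulVec_neg]
  congr 1
  abel

/-- The block perturbation encoded by a stacked vector of entries. -/
def dspOfVec {n m p : ℕ} (g : GIdx n m p → ℝ) : Matrix (Idx n m p) (Idx n m p) ℝ :=
  dsp (Matrix.of fun i j => g (.inl (j, i))) (Matrix.of fun i j => g (.inr (.inl (j, i))))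
    (Matrix.of fun i j => g (.inr (.inr (.inl (j, i)))))
    (Matrix.of fun i j => g (.inr (.inr (.inr (.inl (j, i))))))
    (Matrix.of fun i j => g (.inr (.inr (.inr (.inr (j, i))))))

/-- Every stacked vector comes from a tuple of blocks. -/
theorem exists_vecG_eq {n m p : ℕ} (g : GIdx n m p → ℝ) : ∃ A B C D E, vecG A B C D E = g := by
  refine ⟨Matrix.of fun i j => g (.inl (j, i)), Matrix.of fun i j => g (.inr (.inl (j, i))),
    Matrix.of fun i j => g (.inr (.inr (.inl (j, i)))),
    Matrix.of fun i j => g (.inr (.inr (.inr (.inl (j, i))))),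
    Matrix.of fun i j => g (.inr (.inr (.inr (.inr (j, i))))), ?_⟩
  ext c
  rcases c with c | c | c | c | c <;> rfl

theorem dspOfVec_vecG {n m p : ℕ} (A : Matrix (Fin n) (Fin n) ℝ) (B : Matrix (Fin m) (Fin n) ℝ)
    (C : Matrix (Fin p) (Fin m) ℝ) (D : Matrix (Fin m) (Fin m) ℝ) (E : Matrix (Fin p) (Fin p) ℝ) :
    dspOfVec (vecG A B C D E) = dsp A B C D E := rfl

theorem calG_mulVec {n m p : ℕ} (g : GIdx n m p → ℝ)
    (x : Fin n → ℝ) (y : Fin m → ℝ) (z : Fin p → ℝ) :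
    calG x y z *ᵥ g = dspOfVec g *ᵥ Sum.elim x (Sum.elim y z) := by
  obtain ⟨A, B, C, D, E, rfl⟩ := exists_vecG_eq g
  rw [dspOfVec_vecG, calG_mulVec_vecG]

theorem dspOfVec_zero {n m p : ℕ} : dspOfVec (0 : GIdx n m p → ℝ) = 0 := by
  ext i j
  rcases i with i | i | i <;> rcases j with j | j | j <;> simp [dspOfVec, dsp]

theorem continuous_dspOfVec {n m p : ℕ} :
    Continuous (dspOfVec : (GIdx n m p → ℝ) → Matrix (Idx n m p) (Idx n m p) ℝ) := by
  refine continuous_matrix fun i j => ?_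
  rcases i with i | i | i <;> rcases j with j | j | j <;> simp [dspOfVec, dsp] <;> fun_prop

/-- Entrywise weights with no zero entry have a stacked vector with no zero entry. -/
theorem vecG_ne_zero {n m p : ℕ} {A : Matrix (Fin n) (Fin n) ℝ} {B : Matrix (Fin m) (Fin n) ℝ}
    {C : Matrix (Fin p) (Fin m) ℝ} {D : Matrix (Fin m) (Fin m) ℝ} {E : Matrix (Fin p) (Fin p) ℝ}
    (hA : ∀ i j, A i j ≠ 0) (hB : ∀ i j, B i j ≠ 0) (hC : ∀ i j, C i j ≠ 0)
    (hD : ∀ i j, D i j ≠ 0) (hE : ∀ i j, E i j ≠ 0) (c : GIdx n m p) :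
    vecG A B C D E c ≠ 0 := by
  rcases c with c | c | c | c | c
  exacts [hA _ _, hB _ _, hC _ _, hD _ _, hE _ _]

/-- Theorem 3.1: the unified partial condition number. -/
theorem stmt2 {n m p k : ℕ}
    (A : Matrix (Fin n) (Fin n) ℝ) (B : Matrix (Fin m) (Fin n) ℝ) (C : Matrix (Fin p) (Fin m) ℝ)
    (D : Matrix (Fin m) (Fin m) ℝ) (E : Matrix (Fin p) (Fin p) ℝ)
    (hB : IsUnit (dsp A B C D E).det) (b : Idx n m p → ℝ)
    (x : Fin n → ℝ) (y : Fin m → ℝ) (z : Fin p → ℝ)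
    (hw : Sum.elim x (Sum.elim y z) = ((dsp A B C D E)⁻¹).mulVec b)
    (L : Matrix (Fin k) (Idx n m p) ℝ)
    (ντ : (GIdx n m p ⊕ Idx n m p → ℝ) → ℝ) (νγ : (Fin k → ℝ) → ℝ)
    (hτ0 : ∀ v, ντ v = 0 ↔ v = 0) (hτh : ∀ (c : ℝ) v, ντ (c • v) = |c| * ντ v)
    (hτt : ∀ u v, ντ (u + v) ≤ ντ u + ντ v)
    (hγ0 : ∀ v, νγ v = 0 ↔ v = 0) (hγh : ∀ (c : ℝ) v, νγ (c • v) = |c| * νγ v)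
    (hγt : ∀ u v, νγ (u + v) ≤ νγ u + νγ v)
    (ξ : Fin k → ℝ) (hξ : ∀ i, ξ i ≠ 0) (χ : Idx n m p → ℝ) (hχ : ∀ i, χ i ≠ 0)
    (ΨA : Matrix (Fin n) (Fin n) ℝ) (hΨA : ∀ i j, ΨA i j ≠ 0)
    (ΨB : Matrix (Fin m) (Fin n) ℝ) (hΨB : ∀ i j, ΨB i j ≠ 0)
    (ΨC : Matrix (Fin p) (Fin m) ℝ) (hΨC : ∀ i j, ΨC i j ≠ 0)
    (ΨD : Matrix (Fin m) (Fin m) ℝ) (hΨD : ∀ i j, ΨD i j ≠ 0)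
    (ΨE : Matrix (Fin p) (Fin p) ℝ) (hΨE : ∀ i j, ΨE i j ≠ 0) :
    Tendsto (fun ε : ℝ => sSup {t : ℝ |
        ∃ (ΔA : Matrix (Fin n) (Fin n) ℝ) (ΔB : Matrix (Fin m) (Fin n) ℝ)
          (ΔC : Matrix (Fin p) (Fin m) ℝ) (ΔD : Matrix (Fin m) (Fin m) ℝ)
          (ΔE : Matrix (Fin p) (Fin p) ℝ) (Δb : Idx n m p → ℝ),
          IsUnit (dsp A B C D E + dsp ΔA ΔB ΔC ΔD ΔE).det ∧
          0 < ντ (scaledPert ΨA ΨB ΨC ΨD ΨE χ ΔA ΔB ΔC ΔD ΔE Δb) ∧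
          ντ (scaledPert ΨA ΨB ΨC ΨD ΨE χ ΔA ΔB ΔC ΔD ΔE Δb) ≤ ε ∧
          t = νγ (fun i => (ξ i)⁻¹ *
                (L.mulVec (((dsp A B C D E + dsp ΔA ΔB ΔC ΔD ΔE)⁻¹).mulVec (b + Δb)) i
                  - L.mulVec (((dsp A B C D E)⁻¹).mulVec b) i)) /
              ντ (scaledPert ΨA ΨB ΨC ΨD ΨE χ ΔA ΔB ΔC ΔD ΔE Δb)})
      (𝓝[>] 0)
      (𝓝 (sSup {t : ℝ | ∃ v : GIdx n m p ⊕ Idx n m p → ℝ, v ≠ 0 ∧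
        t = νγ ((Matrix.diagonal (fun i => (ξ i)⁻¹) * L * (dsp A B C D E)⁻¹ *
            hcat (calG x y z) (-1 : Matrix (Idx n m p) (Idx n m p) ℝ) *
            Matrix.fromBlocks (Matrix.diagonal (vecG ΨA ΨB ΨC ΨD ΨE)) 0 0
              (Matrix.diagonal χ)).mulVec v) / ντ v})) := by
  set Q := Matrix.diagonal (fun i => (ξ i)⁻¹) * L
  set ψ := vecG ΨA ΨB ΨC ΨD ΨE with hψ_def
  have hψ : ∀ c, ψ c ≠ 0 := vecG_ne_zero hΨA hΨB hΨC hΨD hΨE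
  set 𝔅 := dsp A B C D E
  set R := hcat (calG x y z) (-1 : Matrix (Idx n m p) (Idx n m p) ℝ) *
    Matrix.fromBlocks (Matrix.diagonal ψ) 0 0 (Matrix.diagonal χ) with hR
  let Δ : (GIdx n m p ⊕ Idx n m p → ℝ) → Matrix (Idx n m p) (Idx n m p) ℝ :=
    fun v => dspOfVec fun c => ψ c * v (.inl c)
  have hΔ0 : Δ 0 = 0 := by
    have h : (fun c => ψ c * (0 : GIdx n m p ⊕ Idx n m p → ℝ) (.inl c)) = 0 := by
      ext
      simp
    exact (congrArg dspOfVec h).trans dspOfVec_zero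
  have hΔc : Continuous Δ := continuous_dspOfVec.comp (by fun_prop)
  have hsum : ContinuousAt (fun v => 𝔅 + Δ v) 0 := (continuous_const.add hΔc).continuousAt
  have hinv : ContinuousAt (fun v => (𝔅 + Δ v)⁻¹) 0 :=
    ContinuousAt.comp (f := fun v => 𝔅 + Δ v) (g := fun N => N⁻¹)
      (continuousAt_matrix_inv _ (by
        rw [hΔ0, add_zero, Ring.inverse_eq_inv']
        exact continuousAt_inv₀ hB.ne_zero)) hsum
  have hT : ContinuousAt (fun v => Q * (𝔅 + Δ v)⁻¹ * R) 0 :=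
    ContinuousAt.comp (f := fun v => (𝔅 + Δ v)⁻¹)
      (g := fun N : Matrix (Idx n m p) (Idx n m p) ℝ => Q * N * R)
      (by fun_prop : Continuous _).continuousAt hinv
  have hP : ∀ᶠ v in 𝓝 0, IsUnit (𝔅 + Δ v).det := by
    simp only [isUnit_iff_ne_zero]
    refine ((continuous_const.add hΔc).matrix_det).continuousAt.eventually_ne ?_
    simpa [hΔ0] using hB.ne_zero
  have hRv : ∀ v, R *ᵥ v = Δ v *ᵥ (𝔅⁻¹ *ᵥ b) - fun i => χ i * v (.inr i) := fun v => by
    rw [hR, ← Matrix.mulVec_mulVec, hcat_mulVec, Matrix.fromBlocks_mulVec]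
    have h1 : Matrix.diagonal ψ *ᵥ (v ∘ Sum.inl) = fun c => ψ c * v (.inl c) := by
      ext c
      simp [Matrix.mulVec_diagonal]
    have h2 : Matrix.diagonal χ *ᵥ (v ∘ Sum.inr) = fun i => χ i * v (.inr i) := by
      ext c
      simp [Matrix.mulVec_diagonal]
    simp only [Matrix.zero_mulVec, add_zero, zero_add, h1, h2, Sum.elim_comp_inl,
      Sum.elim_comp_inr, Matrix.neg_mulVec, Matrix.one_mulVec, calG_mulVec, hw, ← sub_eq_add_neg]
    rfl
  have hF : ∀ v, IsUnit (𝔅 + Δ v).det →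
      νγ (fun i => (ξ i)⁻¹ * (L.mulVec ((𝔅 + Δ v)⁻¹.mulVec (b + fun i => χ i * v (.inr i))) i
        - L.mulVec (𝔅⁻¹.mulVec b) i)) = νγ ((Q * (𝔅 + Δ v)⁻¹ * R) *ᵥ v) := fun v hv => by
    rw [← one_mul (νγ ((Q * (𝔅 + Δ v)⁻¹ * R) *ᵥ v)), ← abs_one, ← abs_neg, ← hγh]
    congr 1
    rw [← Matrix.mulVec_mulVec, ← Matrix.mulVec_mulVec, hRv, neg_one_smul, ← Matrix.mulVec_neg,
      ← inv_add_mulVec_sub hB hv, ← Matrix.mulVec_mulVec, Matrix.mulVec_sub]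
    ext i
    simp [Matrix.mulVec_diagonal]
  have hmain := tendsto_sSup_ratio hT hP hτ0 hτh hτt hγ0 hγh hγt
  simp only [hΔ0, add_zero] at hmain
  simp only [Matrix.mul_assoc Q] at hmain ⊢
  simp only [← hR, Matrix.mul_assoc _ (hcat _ _)]
  refine hmain.congr fun ε => congrArg sSup (Set.ext fun t => ?_)
  constructor
  · rintro ⟨v, hv, hpos, hle, rfl⟩
    obtain ⟨ΔA, ΔB, ΔC, ΔD, ΔE, hΔ⟩ := exists_vecG_eq fun c => ψ c * v (.inl c)
    have hdsp : dsp ΔA ΔB ΔC ΔD ΔE = Δ v := by rw [← dspOfVec_vecG, hΔ]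
    have hscaled :
        scaledPert ΨA ΨB ΨC ΨD ΨE χ ΔA ΔB ΔC ΔD ΔE (fun i => χ i * v (.inr i)) = v := by
      ext c
      rcases c with c | c
      · simp [scaledPert, hΔ, ← hψ_def, hψ c]
      · simp [scaledPert, hχ c]
    refine ⟨ΔA, ΔB, ΔC, ΔD, ΔE, fun i => χ i * v (.inr i), ?_⟩
    rw [hscaled, hdsp, ← Matrix.mul_assoc, ← hF v hv]
    exact ⟨hv, hpos, hle, rfl⟩
  · rintro ⟨ΔA, ΔB, ΔC, ΔD, ΔE, Δb, hu, hpos, hle, rfl⟩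
    set v := scaledPert ΨA ΨB ΨC ΨD ΨE χ ΔA ΔB ΔC ΔD ΔE Δb with hv
    have h1 : Δ v = dsp ΔA ΔB ΔC ΔD ΔE := by
      rw [← dspOfVec_vecG]
      refine congrArg dspOfVec (funext fun c => ?_)
      simp [hv, scaledPert, ← hψ_def, hψ c]
    have h2 : (fun i => χ i * v (.inr i)) = Δb := by
      ext i
      simp [hv, scaledPert, hχ i]
    rw [← h1] at hu ⊢
    refine ⟨v, hu, hpos, hle, ?_⟩
    rw [← Matrix.mul_assoc, ← hF v hu, h2]

end
end

section
/- For any x ∈ ℝⁿ, y ∈ ℝᵐ, z ∈ ℝᵖ, the matrix 𝒢 satisfies 𝒢·𝒢ᵀ = 𝒥, where 𝒥 ∈ ℝ^{l×l} is the block matrix 𝒥 = [[(‖x‖₂² + ‖y‖₂²)·I_n, x·yᵀ, 0],[y·xᵀ, (‖x‖₂² + ‖y‖₂² + ‖z‖₂²)·I_m, y·zᵀ],[0, z·yᵀ, (‖y‖₂² + ‖z‖₂²)·I_p]]. -/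
open Matrix Filter Topology

noncomputable section

theorem euclNorm_sq {ι : Type*} [Fintype ι] (v : ι → ℝ) : euclNorm v ^ 2 = ∑ i, v i ^ 2 :=
  Real.sq_sqrt (Finset.sum_nonneg fun i _ => sq_nonneg (v i))

/-- `𝒢 𝒢ᵀ = 𝒥`. -/
theorem stmt4 {n m p : ℕ} (x : Fin n → ℝ) (y : Fin m → ℝ) (z : Fin p → ℝ) :
    calG x y z * (calG x y z)ᵀ = calJ x y z := by
  ext i j
  rw [Matrix.mul_apply]
  rcases i with i | i | i <;> rcases j with j | j | j <;>
    simp only [calG, calJ, euclNorm_sq, Fintype.sum_sum_type, Fintype.sum_prod_type,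
      Matrix.transpose_apply, Matrix.of_apply, mul_zero, zero_mul, Finset.sum_const_zero,
      add_zero, zero_add, mul_ite, ite_mul, mul_one, one_mul, neg_mul_neg,
      Finset.sum_ite_irrel, Finset.sum_ite_eq, ite_self, Finset.mem_univ, if_true]
  all_goals
    first
    | exact mul_comm _ _
    | by_cases h : i = j
      · subst h
        simp [← sq]
        try ring
      · simp [h]

end
end
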